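/- Fix an integer n ≥ 1, positive integers a, b, a nonnegative integer c and a real p ≥ 1, and set d_n = a b n(n−1)/2 + (c+1)n. Let l, s be reals with s > −d_n and l + s > −d_n, and let f : ℝⁿ∖{0} → ℝ be a continuous function that is positively homogeneous of degree s. Then M_p(‖x‖_p^l · f(x)) = (Γ((d_n + l + s)/p)/Γ((d_n + s)/p)) · M_p(f). -/

import Mathlib

open MeasureTheory Real

/-- The density `∏_{i<j} |x_i^a - x_j^a|^b · ∏_i |x_i|^c` on `ℝⁿ`. -/
noncomputable def fabc (n a b c : ℕ) (x : Fin n → ℝ) : ℝ :=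
  (∏ i : Fin n, ∏ j : Fin n, if i < j then |x i ^ a - x j ^ a| ^ b else 1) *
    ∏ i : Fin n, |x i| ^ c

/-- `M_p(g) = ∫ g(x) f_{a,b,c}(x) exp(-‖x‖_p^p) dx`. -/
noncomputable def Mp (n a b c : ℕ) (p : ℝ) (g : (Fin n → ℝ) → ℝ) : ℝ :=
  ∫ x : Fin n → ℝ, g x * fabc n a b c x * Real.exp (-∑ i, |x i| ^ p)

/-- `d_n = a b n (n-1)/2 + (c+1) n`, as a real number. -/
noncomputable def dnR (n a b c : ℕ) : ℝ :=
  (a : ℝ) * b * n * ((n : ℝ) - 1) / 2 + ((c : ℝ) + 1) * n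

lemma aux_cont_P (n : ℕ) (p : ℝ) (hp : 1 ≤ p) :
    Continuous (fun x : Fin n → ℝ => ∑ i, |x i| ^ p) := by
  refine continuous_finsetSum _ fun i _ => ?_
  exact (continuous_abs.comp (continuous_apply i)).rpow_const fun _ => Or.inr (by linarith)

lemma aux_norm_le (n : ℕ) (p : ℝ) (hp : 1 ≤ p) (x : Fin n → ℝ) :
    ‖x‖ ^ p ≤ ∑ i, |x i| ^ p := by
  have hp0 : 0 < p := by linarith
  have hP : 0 ≤ ∑ i, |x i| ^ p := Finset.sum_nonneg fun i _ => by positivity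
  have h1 : ‖x‖ ≤ (∑ i, |x i| ^ p) ^ (p⁻¹) := by
    refine (pi_norm_le_iff_of_nonneg (by positivity)).2 fun i => ?_
    rw [Real.norm_eq_abs]
    refine (Real.le_rpow_inv_iff_of_pos (abs_nonneg _) hP hp0).2 ?_
    exact Finset.single_le_sum (f := fun i => |x i| ^ p) (fun i _ => by positivity)
      (Finset.mem_univ i)
  exact (Real.le_rpow_inv_iff_of_pos (norm_nonneg _) hP hp0).1 h1

lemma aux_P_smul (n : ℕ) (p : ℝ) (r : ℝ) (hr : 0 < r) (x : Fin n → ℝ) :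
    ∑ i, |(r • x) i| ^ p = r ^ p * ∑ i, |x i| ^ p := by
  rw [Finset.mul_sum]
  refine Finset.sum_congr rfl fun i _ => ?_
  rw [Pi.smul_apply, smul_eq_mul, abs_mul, abs_of_pos hr, Real.mul_rpow hr.le (abs_nonneg _)]

lemma aux_integrable (n : ℕ) (hn : 1 ≤ n) (p : ℝ) (hp : 1 ≤ p) (t : ℝ) (ht : 0 < t + n)
    (h : (Fin n → ℝ) → ℝ) (hc : ContinuousOn h {(0 : Fin n → ℝ)}ᶜ)
    (hh : ∀ r : ℝ, 0 < r → ∀ x : Fin n → ℝ, x ≠ 0 → h (r • x) = r ^ t * h x) :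
    Integrable (fun x => h x * Real.exp (-∑ i, |x i| ^ p)) := by
  have : Nonempty (Fin n) := ⟨⟨0, hn⟩⟩
  have hp0 : 0 < p := by linarith
  obtain ⟨C, hC⟩ : ∃ C, ∀ x ∈ Metric.sphere (0 : Fin n → ℝ) 1, ‖h x‖ ≤ C := by
    refine (isCompact_sphere _ _).exists_bound_of_continuousOn (hc.mono ?_)
    intro x hx h0
    simp only [Set.mem_singleton_iff] at h0
    simp [h0] at hx
  have hI : Integrable (fun x : Fin n → ℝ => C * (‖x‖ ^ t * Real.exp (-‖x‖ ^ p))) := by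
    refine Integrable.const_mul ?_ C
    refine (integrable_fun_norm_addHaar (volume : Measure (Fin n → ℝ))
      (f := fun y => y ^ t * Real.exp (-y ^ p))).2 ?_
    refine (integrableOn_rpow_mul_exp_neg_rpow (p := p) (s := t + n - 1) (by linarith) hp0).congr_fun
      (fun y hy => ?_) measurableSet_Ioi
    have hy' : 0 < y := hy
    simp only [smul_eq_mul, Module.finrank_fin_fun]
    rw [← mul_assoc, ← Real.rpow_natCast, ← Real.rpow_add hy', Nat.cast_sub hn]
    congr 2
    push_cast; ring
  have hae : ∀ᵐ x : Fin n → ℝ, x ≠ 0 := by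
    simp [ae_iff]
  refine hI.mono' ?_ ?_
  · have : ContinuousOn (fun x : Fin n → ℝ => h x * Real.exp (-∑ i, |x i| ^ p)) {0}ᶜ :=
      hc.mul (Real.continuous_exp.comp (aux_cont_P n p hp).neg).continuousOn
    have := this.aestronglyMeasurable (μ := volume) (measurableSet_singleton _).compl
    rwa [restrict_compl_singleton] at this
  · filter_upwards [hae] with x hx
    have hx' : 0 < ‖x‖ := norm_pos_iff.2 hx
    have h1 : h x = ‖x‖ ^ t * h (‖x‖⁻¹ • x) := by
      rw [← hh _ hx' _ (smul_ne_zero (inv_ne_zero hx'.ne') hx), smul_smul,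
        mul_inv_cancel₀ hx'.ne', one_smul]
    have h2 : ‖h (‖x‖⁻¹ • x)‖ ≤ C := hC _ (by simp [norm_smul, hx'.ne'])
    have h3 : Real.exp (-∑ i, |x i| ^ p) ≤ Real.exp (-‖x‖ ^ p) :=
      Real.exp_le_exp.2 (neg_le_neg (aux_norm_le n p hp x))
    have h4 : 0 ≤ ‖x‖ ^ t := by positivity
    have h5 : 0 ≤ C := (norm_nonneg _).trans h2
    rw [norm_mul, h1, norm_mul, Real.norm_of_nonneg h4, Real.norm_of_nonneg (Real.exp_pos _).le]
    calc ‖x‖ ^ t * ‖h (‖x‖⁻¹ • x)‖ * Real.exp (-∑ i, |x i| ^ p)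
        ≤ ‖x‖ ^ t * C * Real.exp (-‖x‖ ^ p) := by gcongr
      _ = _ := by ring

lemma aux_polar (n : ℕ) (hn : 1 ≤ n) (p : ℝ) (hp : 1 ≤ p) (t : ℝ) (ht : 0 < t + n)
    (h : (Fin n → ℝ) → ℝ) (hc : ContinuousOn h {(0 : Fin n → ℝ)}ᶜ)
    (hh : ∀ r : ℝ, 0 < r → ∀ x : Fin n → ℝ, x ≠ 0 → h (r • x) = r ^ t * h x) :
    ∫ x, h x * Real.exp (-∑ i, |x i| ^ p) =
      (1 / p * Real.Gamma ((t + n) / p)) *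
        ∫ x : Metric.sphere (0 : Fin n → ℝ) 1, h x * (∑ i, |x.1 i| ^ p) ^ (-(t + n) / p)
          ∂(volume : Measure (Fin n → ℝ)).toSphere := by
  have : Nonempty (Fin n) := ⟨⟨0, hn⟩⟩
  have hp0 : 0 < p := by linarith
  set F : (Fin n → ℝ) → ℝ := fun x => h x * Real.exp (-∑ i, |x i| ^ p) with hF
  have hFi : Integrable F := aux_integrable n hn p hp t ht h hc hh
  set μ : Measure (Fin n → ℝ) := volume with hμ
  let G : Metric.sphere (0 : Fin n → ℝ) 1 × Set.Ioi (0 : ℝ) → ℝ := fun z => F (z.2.1 • z.1.1)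
  have hG : ∀ x : ({0}ᶜ : Set (Fin n → ℝ)), G (homeomorphUnitSphereProd (Fin n → ℝ) x) = F x.1 := by
    intro x
    have hx : ‖x.1‖ ≠ 0 := norm_ne_zero_iff.2 x.2
    simp [G, smul_smul, hx]
  have hmp := μ.measurePreserving_homeomorphUnitSphereProd
  have e1 : ∫ x, F x = ∫ z, G z ∂(μ.toSphere.prod
      (.volumeIoiPow (Module.finrank ℝ (Fin n → ℝ) - 1))) := by
    rw [← hmp.integral_comp (Homeomorph.measurableEmbedding _) G]
    simp_rw [hG]
    rw [integral_subtype_comap (measurableSet_singleton _).compl F,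
        restrict_compl_singleton]
  have hGi : Integrable G (μ.toSphere.prod
      (.volumeIoiPow (Module.finrank ℝ (Fin n → ℝ) - 1))) := by
    rw [← hmp.integrable_comp_emb (Homeomorph.measurableEmbedding _)]
    have : G ∘ (homeomorphUnitSphereProd (Fin n → ℝ)) = F ∘ Subtype.val := funext hG
    rw [this, ← integrableOn_iff_comap_subtypeVal (measurableSet_singleton _).compl, IntegrableOn,
      restrict_compl_singleton]
    exact hFi
  rw [e1, integral_prod _ hGi, ← integral_const_mul]
  congr 1
  ext θ
  have hθ : θ.1 ≠ 0 := by
    intro h0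
    have := θ.2
    simp [h0] at this
  have hθn : ‖θ.1‖ = 1 := by simp
  have hP : 0 < ∑ i, |θ.1 i| ^ p := by
    have := aux_norm_le n p hp θ.1
    rw [hθn, Real.one_rpow] at this
    linarith
  simp only [Measure.volumeIoiPow, ENNReal.ofReal]
  rw [integral_withDensity_eq_integral_smul]
  · have := integral_subtype_comap (μ := volume) (s := Set.Ioi (0 : ℝ)) measurableSet_Ioi (fun a : ℝ ↦
      Real.toNNReal (a ^ (Module.finrank ℝ (Fin n → ℝ) - 1)) • F (a • θ.1))
    simp only [G]
    rw [this]
    have e2 : ∀ a ∈ Set.Ioi (0 : ℝ),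
        Real.toNNReal (a ^ (Module.finrank ℝ (Fin n → ℝ) - 1)) • F (a • θ.1) =
        h θ * (a ^ (t + n - 1) * Real.exp (-(∑ i, |θ.1 i| ^ p) * a ^ p)) := by
      intro a ha
      have ha' : 0 < a := ha
      rw [NNReal.smul_def, Real.coe_toNNReal _ (pow_nonneg ha'.le _), smul_eq_mul,
        Module.finrank_fin_fun]
      simp only [hF]
      rw [aux_P_smul n p a ha', hh a ha' _ hθ, ← Real.rpow_natCast, Nat.cast_sub hn,
        show t + n - 1 = ((n : ℝ) - (1 : ℕ)) + t by push_cast; ring, Real.rpow_add ha',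
        show -(a ^ p * ∑ i, |θ.1 i| ^ p) = -(∑ i, |θ.1 i| ^ p) * a ^ p by ring]
      ring
    rw [setIntegral_congr_fun measurableSet_Ioi e2, integral_const_mul,
      integral_rpow_mul_exp_neg_mul_rpow hp0 (by linarith) hP]
    rw [sub_add_cancel]
    ring
  · exact (measurable_subtype_coe.pow_const _).real_toNNReal

lemma aux_count (n : ℕ) (k : ℝ) :
    (∏ i : Fin n, ∏ j : Fin n, if i < j then k else 1) = k ^ (n * (n - 1) / 2) := by
  have h1 : ∀ i : Fin n, (∏ j : Fin n, if i < j then k else 1) = k ^ (n - 1 - (i : ℕ)) := by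
    intro i
    rw [← Finset.prod_filter, Finset.prod_const, ← Fin.card_Ioi]
    congr 2
    ext j
    simp
  simp_rw [h1]
  rw [Finset.prod_pow_eq_pow_sum, Fin.sum_univ_eq_sum_range (fun i => n - 1 - i),
    Finset.sum_range_reflect (fun i => i), Finset.sum_range_id]

lemma aux_fabc_smul (n a b c : ℕ) (r : ℝ) (hr : 0 < r) (x : Fin n → ℝ) :
    fabc n a b c (r • x) = r ^ (dnR n a b c - n) * fabc n a b c x := by
  have h1 : (∏ i : Fin n, ∏ j : Fin n,
      if i < j then |(r • x) i ^ a - (r • x) j ^ a| ^ b else 1) =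
      (∏ i : Fin n, ∏ j : Fin n, if i < j then r ^ (a * b) else 1) *
      (∏ i : Fin n, ∏ j : Fin n, if i < j then |x i ^ a - x j ^ a| ^ b else 1) := by
    simp_rw [← Finset.prod_mul_distrib]
    refine Finset.prod_congr rfl fun i _ => Finset.prod_congr rfl fun j _ => ?_
    split_ifs
    · simp only [Pi.smul_apply, smul_eq_mul]
      rw [mul_pow, mul_pow, ← mul_sub, abs_mul, abs_of_pos (pow_pos hr a), mul_pow, pow_mul]
    · simp
  have h2 : (∏ i : Fin n, |(r • x) i| ^ c) = r ^ (c * n) * ∏ i : Fin n, |x i| ^ c := by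
    simp only [Pi.smul_apply, smul_eq_mul, abs_mul, abs_of_pos hr, mul_pow,
      Finset.prod_mul_distrib, Finset.prod_const, Finset.card_univ, Fintype.card_fin, pow_mul]
  have h3 : dnR n a b c - n = ((a * b * (n * (n - 1) / 2) + c * n : ℕ) : ℝ) := by
    have : ((n * (n - 1) / 2 : ℕ) : ℝ) = (n : ℝ) * (n - 1) / 2 := by
      rw [Nat.cast_div (Nat.even_mul_pred_self n).two_dvd (by norm_num)]
      rcases n with _ | n
      · simp
      · push_cast; simp
    push_cast [this]
    unfold dnR
    ring
  unfold fabc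
  rw [h1, h2, aux_count, h3, Real.rpow_natCast, ← pow_mul, pow_add]
  ring

lemma aux_fabc_cont (n a b c : ℕ) : Continuous (fabc n a b c) := by
  unfold fabc
  refine Continuous.mul ?_ (by fun_prop)
  refine continuous_finsetProd _ fun i _ => continuous_finsetProd _ fun j _ => ?_
  split_ifs <;> fun_prop

/-- If `s > -d_n`, `l + s > -d_n` and `f` is continuous away from `0` and
positively homogeneous of degree `s`, then
`M_p(‖x‖_p^l f(x)) = (Γ((d_n+l+s)/p)/Γ((d_n+s)/p)) · M_p(f)`. -/
theorem statement6 (n a b c : ℕ) (hn : 1 ≤ n) (ha : 1 ≤ a) (hb : 1 ≤ b) (p : ℝ) (hp : 1 ≤ p)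
    (l s : ℝ) (hs : -dnR n a b c < s) (hls : -dnR n a b c < l + s)
    (f : (Fin n → ℝ) → ℝ) (hf : ContinuousOn f {(0 : Fin n → ℝ)}ᶜ)
    (hhom : ∀ r : ℝ, 0 < r → ∀ x : Fin n → ℝ, x ≠ 0 → f (r • x) = r ^ s * f x) :
    Mp n a b c p (fun x => ((∑ i, |x i| ^ p) ^ (1 / p)) ^ l * f x) =
      Real.Gamma ((dnR n a b c + l + s) / p) / Real.Gamma ((dnR n a b c + s) / p) *
        Mp n a b c p f := by
  have hp0 : 0 < p := by linarith
  set d := dnR n a b c with hd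
  have hPpos : ∀ x : Fin n → ℝ, x ≠ 0 → 0 < ∑ i, |x i| ^ p := fun x hx =>
    lt_of_lt_of_le (Real.rpow_pos_of_pos (norm_pos_iff.2 hx) p) (aux_norm_le n p hp x)
  have hc1 : ContinuousOn (fun x => f x * fabc n a b c x) {(0 : Fin n → ℝ)}ᶜ :=
    hf.mul (aux_fabc_cont n a b c).continuousOn
  have hNc : ContinuousOn (fun x : Fin n → ℝ => ((∑ i, |x i| ^ p) ^ (1 / p)) ^ l) {0}ᶜ := by
    refine ContinuousOn.rpow_const (ContinuousOn.rpow_const (aux_cont_P n p hp).continuousOn ?_) ?_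
    · exact fun x hx => Or.inl (hPpos x hx).ne'
    · exact fun x hx => Or.inl (Real.rpow_pos_of_pos (hPpos x hx) _).ne'
  have hh1 : ∀ r : ℝ, 0 < r → ∀ x : Fin n → ℝ, x ≠ 0 →
      f (r • x) * fabc n a b c (r • x) = r ^ (s + (d - n)) * (f x * fabc n a b c x) := by
    intro r hr x hx
    rw [hhom r hr x hx, aux_fabc_smul n a b c r hr, Real.rpow_add hr]
    ring
  have hh2 : ∀ r : ℝ, 0 < r → ∀ x : Fin n → ℝ, x ≠ 0 →
      ((∑ i, |(r • x) i| ^ p) ^ (1 / p)) ^ l * f (r • x) * fabc n a b c (r • x) =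
      r ^ (l + (s + (d - n))) * (((∑ i, |x i| ^ p) ^ (1 / p)) ^ l * f x * fabc n a b c x) := by
    intro r hr x hx
    have h0 := (hPpos x hx).le
    rw [mul_assoc, hh1 r hr x hx, aux_P_smul n p r hr, Real.mul_rpow (by positivity) h0,
      ← Real.rpow_mul hr.le, mul_one_div_cancel hp0.ne', Real.rpow_one,
      Real.mul_rpow hr.le (by positivity), Real.rpow_add hr l]
    ring
  have k1 := aux_polar n hn p hp (s + (d - n)) (by linarith) _ hc1 hh1
  have k2 := aux_polar n hn p hp (l + (s + (d - n))) (by linarith) _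
    ((hNc.mul hf).mul (aux_fabc_cont n a b c).continuousOn) hh2
  have hΓ : Real.Gamma ((d + s) / p) ≠ 0 :=
    (Real.Gamma_pos_of_pos (div_pos (by linarith) hp0)).ne'
  unfold Mp
  rw [k1]
  refine k2.trans ?_
  rw [show l + (s + (d - n)) + n = d + l + s by ring, show s + (d - n) + n = d + s by ring]
  have e : ∀ x : Metric.sphere (0 : Fin n → ℝ) 1,
      ((∑ i, |x.1 i| ^ p) ^ (1 / p)) ^ l * f x * fabc n a b c x *
        (∑ i, |x.1 i| ^ p) ^ (-(d + l + s) / p) =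
      f x * fabc n a b c x * (∑ i, |x.1 i| ^ p) ^ (-(d + s) / p) := by
    intro x
    have hx : x.1 ≠ 0 := by
      intro h0
      have := x.2
      simp [h0] at this
    have h0 := hPpos x.1 hx
    rw [← Real.rpow_mul h0.le,
      show -(d + s) / p = 1 / p * l + -(d + l + s) / p by ring, Real.rpow_add h0]
    ring
  have e' := integral_congr_ae (μ := (volume : Measure (Fin n → ℝ)).toSphere)
    (Filter.Eventually.of_forall e)
  refine (congrArg _ e').trans ?_
  field_simp
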